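/- Let k be any field, G a finitely generated group, n a natural number, ρ : G → GL(n, k) a group homomorphism, and g ∈ G with ρ(g) ≠ 1. Then there exists a finite group H and a group homomorphism φ : G → H with φ(g) ≠ 1. -/

import Mathlib

theorem isJacobsonRing_int_aux : IsJacobsonRing ℤ := by
  rw [isJacobsonRing_iff_prime_eq]
  intro P hP
  by_cases h : P = ⊥
  · subst h
    rw [eq_bot_iff]
    intro x hx
    rw [Ideal.mem_jacobson_bot] at hx
    have h1 := hx x
    have h2 := hx (-x)
    rw [Int.isUnit_iff] at h1 h2
    rw [Ideal.mem_bot]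
    have : 0 ≤ x * x := mul_self_nonneg x
    have : x * x = 0 := by grind
    simpa using this
  · have : P.IsMaximal := hP.isMaximal h
    exact Ideal.jacobson_eq_self_of_isMaximal

theorem finite_field_of_finiteType_int (F : Type) [Field F] [Algebra.FiniteType ℤ F] :
    Finite F := by
  have := isJacobsonRing_int_aux
  have hfin : Module.Finite ℤ F := finite_of_finite_type_of_isJacobsonRing ℤ F
  obtain ⟨p, hp⟩ := CharP.exists F
  by_cases h0 : p = 0
  · subst h0
    have : CharZero F := CharP.charP_to_charZero F
    have hi : Function.Injective (algebraMap ℤ F) := by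
      simpa using Int.cast_injective (α := F)
    exact absurd (isField_of_isIntegral_of_isField hi (Field.toIsField F)) Int.not_isField
  · apply Module.finite_of_fg_torsion
    intro x
    refine ⟨⟨(p : ℤ), mem_nonZeroDivisors_of_ne_zero (by exact_mod_cast h0)⟩, ?_⟩
    change (p : ℤ) • x = 0
    simp

/-- Malcev's theorem for linear groups over an arbitrary field `k`: if `G` is a
finitely generated group, `ρ : G → GL(n, k)` a homomorphism and `g ∈ G` with
`ρ g ≠ 1`, then there is a finite group `H` and a homomorphism `φ : G → H` with
`φ g ≠ 1`. -/
theorem stmt4 (k : Type) [Field k] (G : Type) [Group G] [Group.FG G] (n : ℕ)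
    (ρ : G →* Matrix.GeneralLinearGroup (Fin n) k) (g : G) (hg : ρ g ≠ 1) :
    ∃ (H : Type) (_ : Group H), Finite H ∧ ∃ φ : G →* H, φ g ≠ 1 := by
  obtain ⟨S, hS, hSf⟩ := Group.fg_iff.mp (inferInstance : Group.FG G)
  let E : Set k := ⋃ s ∈ S, ⋃ i : Fin n, ⋃ j : Fin n,
    {(ρ s : Matrix (Fin n) (Fin n) k) i j, ((ρ s)⁻¹).1 i j}
  have hE : E.Finite := hSf.biUnion fun s _ => Set.finite_iUnion fun i =>
    Set.finite_iUnion fun j => Set.toFinite _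
  let A : Subalgebra ℤ k := Algebra.adjoin ℤ E
  have hA : Algebra.FiniteType ℤ A := .adjoin_of_finite hE
  let ι : A →+* k := A.val.toRingHom
  have hι : Function.Injective ι := Subtype.val_injective
  let f : Matrix.GeneralLinearGroup (Fin n) A →* Matrix.GeneralLinearGroup (Fin n) k :=
    Matrix.GeneralLinearGroup.map ι
  have hf : Function.Injective f := by
    intro M N h
    ext i j
    exact congrArg (fun X : Matrix.GeneralLinearGroup (Fin n) k => X.1 i j) h
  have hr : ∀ x, ρ x ∈ f.range := by
    have : Subgroup.closure S ≤ f.range.comap ρ := by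
      rw [Subgroup.closure_le]
      intro s hs
      have h1 : ∀ i j, (ρ s).1 i j ∈ A := fun i j => Algebra.subset_adjoin (by
        simp only [E, Set.mem_iUnion]; exact ⟨s, hs, i, j, Or.inl rfl⟩)
      have h2 : ∀ i j, ((ρ s)⁻¹).1 i j ∈ A := fun i j => Algebra.subset_adjoin (by
        simp only [E, Set.mem_iUnion]; exact ⟨s, hs, i, j, Or.inr rfl⟩)
      let M : Matrix (Fin n) (Fin n) A := fun i j => ⟨_, h1 i j⟩
      let N : Matrix (Fin n) (Fin n) A := fun i j => ⟨_, h2 i j⟩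
      have hM : ι.mapMatrix M = (ρ s).1 := rfl
      have hN : ι.mapMatrix N = ((ρ s)⁻¹).1 := rfl
      have hinj : Function.Injective (ι.mapMatrix (m := Fin n)) := Matrix.map_injective hι
      refine ⟨⟨M, N, hinj ?_, hinj ?_⟩, ?_⟩
      · rw [map_mul, hM, hN, map_one]; exact (ρ s).mul_inv
      · rw [map_mul, hM, hN, map_one]; exact (ρ s).inv_mul
      · ext i j; rfl
    intro x
    exact this (hS ▸ Subgroup.mem_top x)
  let ρ' : G →* Matrix.GeneralLinearGroup (Fin n) A :=
    (MonoidHom.ofInjective hf).symm.toMonoidHom.comp (ρ.codRestrict f.range hr)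
  have hρ' : ρ' g ≠ 1 := by
    intro h
    have h3 : ρ.codRestrict f.range hr g = 1 :=
      (MonoidHom.ofInjective hf).symm.map_eq_one_iff.mp h
    exact hg (congrArg Subtype.val h3)
  obtain ⟨i, j, hij⟩ : ∃ i j, (ρ' g).1 i j - (1 : Matrix (Fin n) (Fin n) A) i j ≠ 0 := by
    by_contra! h
    exact hρ' (Units.ext (Matrix.ext fun i j => sub_eq_zero.mp (h i j)))
  have := isJacobsonRing_int_aux
  have hJ : IsJacobsonRing A := isJacobsonRing_of_finiteType (A := ℤ)
  obtain ⟨m, hm, ham⟩ : ∃ m : Ideal A, m.IsMaximal ∧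
      (ρ' g).1 i j - (1 : Matrix (Fin n) (Fin n) A) i j ∉ m := by
    by_contra! h
    have h4 : (ρ' g).1 i j - (1 : Matrix (Fin n) (Fin n) A) i j ∈ (⊥ : Ideal A).jacobson :=
      Ideal.mem_sInf.mpr fun {I} hI => h I hI.2
    rw [isJacobsonRing_iff_prime_eq.mp hJ ⊥ Ideal.isPrime_bot] at h4
    exact hij h4
  let _ := Ideal.Quotient.field m
  have hq : Finite (A ⧸ m) := by
    refine @finite_field_of_finiteType_int (A ⧸ m) _ ?_
    let π : A →+* (A ⧸ m) := Ideal.Quotient.mk m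
    exact Algebra.FiniteType.of_surjective (RingHom.toIntAlgHom π) Ideal.Quotient.mk_surjective
  refine ⟨Matrix.GeneralLinearGroup (Fin n) (A ⧸ m), inferInstance, ?_,
    (Matrix.GeneralLinearGroup.map (Ideal.Quotient.mk m)).comp ρ', ?_⟩
  · have : Finite (Matrix (Fin n) (Fin n) (A ⧸ m)) := inferInstanceAs (Finite (Fin n → Fin n → A ⧸ m))
    exact Finite.of_injective (fun x => x.1) Units.val_injective
  · intro h
    apply ham
    rw [← Ideal.Quotient.eq_zero_iff_mem, map_sub, sub_eq_zero]
    have h5 := congrArg (fun X : Matrix.GeneralLinearGroup (Fin n) (A ⧸ m) => X.1 i j) h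
    have h6 : (Ideal.Quotient.mk m) ((ρ' g).1 i j) = (1 : Matrix (Fin n) (Fin n) (A ⧸ m)) i j := h5
    rw [h6, Matrix.one_apply, Matrix.one_apply]
    split_ifs <;> simp
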